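/- Let G be an SGK graph and let k be a positive integer. If α_k(G) - α_{k-1}(G) = α_{k+1}(G) - α_k(G), then every k-saturated clique partition of G is also (k+1)-saturated. -/

import Mathlib

/-- `s` is an independent set of the graph `G`. -/
def IndepSet {V : Type*} (G : SimpleGraph V) (s : Set V) : Prop :=
  ∀ ⦃v⦄, v ∈ s → ∀ ⦃w⦄, w ∈ s → ¬ G.Adj v w

/-- `α_k(G)`: the maximum number of vertices in a union of `k` independent sets. -/
noncomputable def alphak {V : Type*} (G : SimpleGraph V) (k : ℕ) : ℕ :=
  sSup {n | ∃ A : Fin k → Set V, (∀ i, IndepSet G (A i)) ∧ (⋃ i, A i).ncard = n}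

/-- `ω_k(G)`: the maximum number of vertices in a union of `k` cliques. -/
noncomputable def omegak {V : Type*} (G : SimpleGraph V) (k : ℕ) : ℕ :=
  sSup {n | ∃ A : Fin k → Set V, (∀ i, G.IsClique (A i)) ∧ (⋃ i, A i).ncard = n}

/-- The clique number `ω(G)`. -/
noncomputable def cliqueNumber {V : Type*} (G : SimpleGraph V) : ℕ :=
  sSup {n | ∃ s : Set V, G.IsClique s ∧ s.ncard = n}

/-- The independence number `α(G)`. -/
noncomputable def indepNumber {V : Type*} (G : SimpleGraph V) : ℕ :=
  sSup {n | ∃ s : Set V, IndepSet G s ∧ s.ncard = n}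

/-- `f` encodes a partition of the vertices of `G` into cliques:
its (nonempty) fibers are the cliques. -/
def IsCliquePartition {V : Type*} (G : SimpleGraph V) (f : V → V) : Prop :=
  ∀ i : V, G.IsClique (f ⁻¹' {i})

/-- The `k`-norm of the partition encoded by `f`: `Σ_C min (k, |C|)`. -/
noncomputable def knorm {V : Type*} [Fintype V] (f : V → V) (k : ℕ) : ℕ :=
  ∑ i : V, min k (f ⁻¹' {i}).ncard

/-- `G` is a strong Greene–Kleitman (SGK) graph: every induced subgraph has, for every
positive `k`, a clique partition that is simultaneously `k`- and `k+1`-saturated. -/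
def SGK {V : Type*} [Fintype V] (G : SimpleGraph V) : Prop :=
  ∀ (s : Finset V) (k : ℕ), 0 < k →
    ∃ f : (↑s : Set V) → (↑s : Set V),
      IsCliquePartition (G.induce ↑s) f ∧
      knorm f k = alphak (G.induce ↑s) k ∧
      knorm f (k + 1) = alphak (G.induce ↑s) (k + 1)

/-- An SGK graph is polyunsaturated if no clique partition is simultaneously `k`- and
`l`-saturated for distinct nonconsecutive positive `k, l` below the clique number. -/
def PolyunsatG {V : Type*} [Fintype V] (G : SimpleGraph V) : Prop :=
  ∀ k l : ℕ, 0 < k → 0 < l → k < cliqueNumber G → l < cliqueNumber G →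
    (k + 2 ≤ l ∨ l + 2 ≤ k) →
    ¬ ∃ f : V → V, IsCliquePartition G f ∧ knorm f k = alphak G k ∧ knorm f l = alphak G l

/-- `G` is a comparability graph: adjacency is comparability in some partial order. -/
def IsComparabilityGraph {V : Type*} (G : SimpleGraph V) : Prop :=
  ∃ r : V → V → Prop, IsPartialOrder V r ∧ ∀ v w, G.Adj v w ↔ (v ≠ w ∧ (r v w ∨ r w v))


/-- A clique meets a union of `k` independent sets in at most `k` vertices. -/
theorem SimpleGraph.IsClique.ncard_iUnion_indepSet_inter_le {V : Type*} {G : SimpleGraph V}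
    {k : ℕ} {A : Fin k → Set V} (hA : ∀ i, IndepSet G (A i)) {C : Set V} (hC : G.IsClique C) :
    ((⋃ i, A i) ∩ C).ncard ≤ k := by
  have hmem : ∀ v : ((⋃ i, A i) ∩ C : Set V), ∃ i, (v : V) ∈ A i :=
    fun v => Set.mem_iUnion.mp v.2.1
  choose g hg using hmem
  have hinj : Function.Injective g := by
    intro v w hvw
    by_contra hne
    exact hA (g v) (hg v) (hvw ▸ hg w) (hC v.2.2 w.2.2 fun e => hne (Subtype.ext e))
  simpa [Nat.card_coe_set_eq] using Nat.card_le_card_of_injective g hinj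

/-- Every clique partition has `k`-norm at least `α_k(G)`. -/
theorem IsCliquePartition.alphak_le_knorm {V : Type*} [Fintype V] {G : SimpleGraph V}
    {f : V → V} (hf : IsCliquePartition G f) (k : ℕ) : alphak G k ≤ knorm f k := by
  classical
  refine csSup_le ⟨_, fun _ => ∅, fun _ _ hv => hv.elim, rfl⟩ ?_
  rintro n ⟨A, hA, rfl⟩
  have hsum : (⋃ i, A i).ncard = ∑ j : V, ((⋃ i, A i) ∩ f ⁻¹' {j}).ncard := by
    rw [Set.ncard_eq_toFinset_card',
      Finset.card_eq_sum_card_fiberwise (f := f) (t := Finset.univ) (by simp)]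
    refine Finset.sum_congr rfl fun j _ => ?_
    rw [Set.ncard_eq_toFinset_card']
    congr 1
    ext v
    simp
  rw [hsum]
  exact Finset.sum_le_sum fun j _ => le_min ((hf j).ncard_iUnion_indepSet_inter_le hA)
    (Set.ncard_le_ncard Set.inter_subset_right)

/-- The `k`-norm is concave in `k`. -/
theorem knorm_succ_add_knorm_pred_le {V : Type*} [Fintype V] (f : V → V) {k : ℕ} (hk : 0 < k) :
    knorm f (k + 1) + knorm f (k - 1) ≤ 2 * knorm f k := by
  unfold knorm
  rw [← Finset.sum_add_distrib, Finset.mul_sum]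
  exact Finset.sum_le_sum fun j _ => by omega

/-- If `G` is an SGK graph, `k` is positive, and `Δα_k(G) = Δα_{k+1}(G)` (stated
additively), then every `k`-saturated clique partition of `G` is `(k+1)`-saturated. -/
theorem statement8 {V : Type*} [Fintype V] (G : SimpleGraph V) (hG : SGK G)
    (k : ℕ) (hk : 0 < k)
    (h : alphak G (k + 1) + alphak G (k - 1) = 2 * alphak G k) :
    ∀ f : V → V, IsCliquePartition G f → knorm f k = alphak G k →
      knorm f (k + 1) = alphak G (k + 1) := by
  intro f hf hfk
  have hconcave := knorm_succ_add_knorm_pred_le f hk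
  have hsucc := hf.alphak_le_knorm (k + 1)
  have hpred := hf.alphak_le_knorm (k - 1)
  omega
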